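/- For any set K of morphisms of the category Set of sets, the pair (cof(K), inj(K)) is a weak factorization system on Set. -/

import Mathlib

universe u

/-- A class of morphisms of the category `Set` of sets. -/
abbrev MapClass : Type (u + 1) := ∀ (X Y : Type u), (X → Y) → Prop

/-- `i` has the left lifting property (LLP) with respect to `p`
(equivalently, `p` has the right lifting property (RLP) with respect to `i`):
every commutative square `p ∘ α = β ∘ i` admits a diagonal filler `g`. -/
def LiftSq {A B X Y : Type u} (i : A → B) (p : X → Y) : Prop :=
  ∀ (α : A → X) (β : B → Y), p ∘ α = β ∘ i →
    ∃ g : B → X, g ∘ i = α ∧ p ∘ g = β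

/-- `(L, R)` is a weak factorization system on the category of sets:
`L` is exactly the class of maps having the LLP with respect to every member of `R`,
`R` is exactly the class of maps having the RLP with respect to every member of `L`,
and every set map factors as `r ∘ l` with `l ∈ L` and `r ∈ R`. -/
structure IsWFS (L R : MapClass.{u}) : Prop where
  left_iff : ∀ {A B : Type u} (i : A → B),
    L A B i ↔ ∀ {X Y : Type u} (p : X → Y), R X Y p → LiftSq i p
  right_iff : ∀ {X Y : Type u} (p : X → Y),
    R X Y p ↔ ∀ {A B : Type u} (i : A → B), L A B i → LiftSq i p
  factor : ∀ {X Y : Type u} (f : X → Y),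
    ∃ (Z : Type u) (l : X → Z) (r : Z → Y), L X Z l ∧ R Z Y r ∧ r ∘ l = f

/-- `inj(K)`: the class of set maps having the RLP with respect to every member of the
set of maps `K`, given as a family indexed by a (small) index type `ι`. -/
def injF {ι : Type u} {A B : ι → Type u} (k : ∀ i, A i → B i) : MapClass.{u} :=
  fun X Y p => ∀ i, LiftSq (k i) p

/-- `cof(K)`: the class of set maps having the LLP with respect to every member of
`inj(K)`. -/
def cofF {ι : Type u} {A B : ι → Type u} (k : ∀ i, A i → B i) : MapClass.{u} :=
  fun X Y f => ∀ {Z T : Type u} (p : Z → T), injF k Z T p → LiftSq f p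

open CategoryTheory MorphismProperty

theorem liftSq_iff_hasLiftingProperty {A B X Y : Type u} (i : A → B) (p : X → Y) :
    LiftSq i p ↔ HasLiftingProperty (↾i) (↾p) := by
  constructor
  · refine fun h ↦ ⟨fun {f g} sq ↦ ?_⟩
    obtain ⟨l, hl, hl'⟩ := h f g (by
      funext x
      exact ConcreteCategory.congr_hom sq.w x)
    refine ⟨⟨⟨↾l, ?_, ?_⟩⟩⟩
    · ext x
      exact congrFun hl x
    · ext x
      exact congrFun hl' x
  · intro h α β w
    have sq : CommSq (↾α) (↾i) (↾p) (↾β) := ⟨by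
      ext x
      exact congrFun w x⟩
    refine ⟨sq.lift, ?_, ?_⟩
    · funext x
      exact ConcreteCategory.congr_hom sq.fac_left x
    · funext x
      exact ConcreteCategory.congr_hom sq.fac_right x

theorem injF_iff_rlp {ι : Type u} {A B : ι → Type u} (k : ∀ i, A i → B i)
    {X Y : Type u} (p : X → Y) :
    injF k X Y p ↔ (ofHoms fun i ↦ ↾(k i)).rlp (↾p) := by
  constructor
  · rintro h _ _ _ ⟨i⟩
    exact (liftSq_iff_hasLiftingProperty _ _).1 (h i)
  · exact fun h i ↦ (liftSq_iff_hasLiftingProperty _ _).2 (h _ ⟨i⟩)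

theorem cofF_of_llp_rlp {ι : Type u} {A B : ι → Type u} (k : ∀ i, A i → B i)
    {X Y : Type u} (f : X → Y) (hf : (ofHoms fun i ↦ ↾(k i)).rlp.llp (↾f)) :
    cofF k X Y f :=
  fun p hp ↦ (liftSq_iff_hasLiftingProperty f p).2 (hf _ ((injF_iff_rlp k p).1 hp))

theorem hasSmallObjectArgument_of_isSmall (I : MorphismProperty (Type u)) [IsSmall.{u} I] :
    HasSmallObjectArgument.{u} I := by
  obtain ⟨ι, A, B, k, rfl⟩ := (isSmall_iff_eq_ofHoms.{u} I).1 inferInstance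
  obtain ⟨κ, hκ, hA⟩ := HasCardinalLT.exists_regular_cardinal_forall.{u} A
  have : Fact κ.IsRegular := ⟨hκ⟩
  have : Nonempty κ.ord.ToType := by simpa using hκ.ne_zero
  have := WellFoundedLT.toOrderBot κ.ord.ToType
  refine ⟨κ, inferInstance, inferInstance, { preservesColimit := ?_ }⟩
  rintro _ _ _ _ _ ⟨i⟩ f hf
  have := (hA i).isCardinalPresentable
  have := preservesColimitsOfShape_of_isCardinalPresentable (A i) κ κ.ord.ToType
  infer_instance

/-- For any set `K` of morphisms of sets, the pair `(cof(K), inj(K))` is a weak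
factorization system on the category of sets. -/
theorem cof_inj_isWFS {ι : Type u} {A B : ι → Type u} (k : ∀ i, A i → B i) :
    IsWFS (cofF k) (injF k) where
  left_iff _ := Iff.rfl
  right_iff p :=
    ⟨fun hp _ _ _ hi ↦ hi p hp, fun h i ↦ h (k i) fun _ hq ↦ hq i⟩
  factor f := by
    have := hasSmallObjectArgument_of_isSmall (ofHoms fun i ↦ ↾(k i))
    let d := factorizationData (ofHoms fun i ↦ ↾(k i)).rlp.llp (ofHoms fun i ↦ ↾(k i)).rlp (↾f)
    exact ⟨d.Z, d.i, d.p, cofF_of_llp_rlp k _ d.hi, (injF_iff_rlp k _).2 d.hp,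
      funext fun x ↦ ConcreteCategory.congr_hom d.fac x⟩
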